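/- arXiv:2503.03551 — 3 statements merged into one kernel-verified Lean document; each statement's English description precedes it below -/
import Mathlib

section
/- Let A be an algebra and let δ, θ, α be congruences of A with θ ≤ α such that C(α, θ; δ) holds. Then for every pair ((a,a'),(b,b')) ∈ Δ_{θ,α}, one has (a,a') ∈ δ if and only if (b,b') ∈ δ. -/
namespace Zhuk

/-- A signature: a type of operation symbols with arities. -/
structure Signature where
  ops : Type
  arity : ops → ℕ

/-- An algebra structure of signature `S` on carrier `A`. -/
class SAlg (S : Signature) (A : Type) where
  interp : (o : S.ops) → (Fin (S.arity o) → A) → A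

variable {S : Signature}

/-- Componentwise algebra structure on a product. -/
instance prodSAlg {A B : Type} [SAlg S A] [SAlg S B] : SAlg S (A × B) :=
  ⟨fun o x => (SAlg.interp o fun i => (x i).1, SAlg.interp o fun i => (x i).2)⟩

/-- A subset closed under all the operations. -/
def IsSubuniverse (S : Signature) {A : Type} [SAlg S A] (R : Set A) : Prop :=
  ∀ (o : S.ops) (x : Fin (S.arity o) → A), (∀ i, x i ∈ R) → SAlg.interp o x ∈ R

/-- The algebra structure on (the subtype of) a subuniverse. -/
def subAlg {A : Type} [SAlg S A] (R : Set A) (h : IsSubuniverse S R) : SAlg S ↥R :=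
  ⟨fun o x => ⟨SAlg.interp o fun i => (x i).1, h o _ fun i => (x i).2⟩⟩

/-- Terms of signature `S` in `n` variables. -/
inductive STerm (S : Signature) (n : ℕ) : Type
  | var : Fin n → STerm S n
  | app (o : S.ops) : (Fin (S.arity o) → STerm S n) → STerm S n

/-- Evaluation of a term in an algebra. -/
def STerm.eval {A : Type} [SAlg S A] {n : ℕ} : STerm S n → (Fin n → A) → A
  | .var i, v => v i
  | .app o ts, v => SAlg.interp o fun i => (ts i).eval v

/-- The diagonal (smallest) congruence `0_A`. -/
def diag (A : Type) : Set (A × A) := {p | p.1 = p.2}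

/-- Relational composition. -/
def rcomp {A B C : Type} (R : Set (A × B)) (T : Set (B × C)) : Set (A × C) :=
  {p | ∃ b, (p.1, b) ∈ R ∧ (b, p.2) ∈ T}

/-- Relational inverse. -/
def rinv {A B : Type} (R : Set (A × B)) : Set (B × A) := {p | (p.2, p.1) ∈ R}

/-- Transitive closure of a binary relation (as a set of pairs). -/
def transCl {A : Type} (R : Set (A × A)) : Set (A × A) :=
  {p | Relation.TransGen (fun a b => (a, b) ∈ R) p.1 p.2}

/-- `R` is stable under (saturated with respect to) `ρ`:  `R = ρ ∘ R ∘ ρ`. -/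
def Saturated {A : Type} (ρ R : Set (A × A)) : Prop := rcomp ρ (rcomp R ρ) = R

/-- A congruence: a subuniverse of `A²` which is an equivalence relation. -/
def IsCongruence (S : Signature) {A : Type} [SAlg S A] (θ : Set (A × A)) : Prop :=
  IsSubuniverse S θ ∧ Equivalence fun a b => (a, b) ∈ θ

/-- `ρ ∈ Con*(A)`: a congruence different from the full congruence `1_A`. -/
def ConStar (S : Signature) {A : Type} [SAlg S A] (ρ : Set (A × A)) : Prop :=
  IsCongruence S ρ ∧ ρ ≠ Set.univ

/-- The ternary centralizer relation `C(φ, θ; δ)`, via the term condition. -/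
def Centralizes (S : Signature) {A : Type} [SAlg S A] (φ θ δ : Set (A × A)) : Prop :=
  ∀ (n : ℕ) (t : STerm S (n + 1)) (a b : A) (c d : Fin n → A),
    (a, b) ∈ φ → (∀ i, (c i, d i) ∈ θ) →
    (t.eval (Fin.cons a c), t.eval (Fin.cons a d)) ∈ δ →
    (t.eval (Fin.cons b c), t.eval (Fin.cons b d)) ∈ δ

/-- The centralizer `(δ : θ)`: the largest congruence `φ` with `C(φ, θ; δ)`. -/
def centralizer (S : Signature) {A : Type} [SAlg S A] (δ θ : Set (A × A)) : Set (A × A) :=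
  ⋃₀ {φ | IsCongruence S φ ∧ Centralizes S φ θ δ}

/-- A congruence of the subalgebra `A(θ) ≤ A²`, viewed ambiently as a subset of
`(A×A) × (A×A)` whose field is `θ`. -/
def IsConOn (S : Signature) {A : Type} [SAlg S A] (θ : Set (A × A))
    (Δ : Set ((A × A) × (A × A))) : Prop :=
  Δ ⊆ θ ×ˢ θ ∧ IsSubuniverse S Δ ∧ (∀ p ∈ θ, (p, p) ∈ Δ) ∧
    (∀ p q, (p, q) ∈ Δ → (q, p) ∈ Δ) ∧ (∀ p q r, (p, q) ∈ Δ → (q, r) ∈ Δ → (p, r) ∈ Δ)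

/-- `Δ_{θ,α}`: the congruence of `A(θ)` generated by `{((a,a),(b,b)) : (a,b) ∈ α}`. -/
def DeltaCon (S : Signature) {A : Type} [SAlg S A] (θ α : Set (A × A)) :
    Set ((A × A) × (A × A)) :=
  ⋂₀ {Δ | IsConOn S θ Δ ∧ ∀ a b : A, (a, b) ∈ α → ((a, a), (b, b)) ∈ Δ}

/-- Projection of a quaternary relation to its first two coordinates. -/
def pr12 {A B : Type} (T : Set (A × A × B × B)) : Set (A × A) :=
  {p | ∃ b₁ b₂, (p.1, p.2, b₁, b₂) ∈ T}

/-- Projection of a quaternary relation to its last two coordinates. -/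
def pr34 {A B : Type} (T : Set (A × A × B × B)) : Set (B × B) :=
  {q | ∃ a₁ a₂, (a₁, a₂, q.1, q.2) ∈ T}

/-- The trace of a quaternary relation. -/
def btr {A B : Type} (T : Set (A × A × B × B)) : Set (A × B) :=
  {p | (p.1, p.1, p.2, p.2) ∈ T}

/-- Zhuk's bridges: Definition 4.3 (B0*), (B1*), (B2*). -/
def IsBridge (S : Signature) {A B : Type} [SAlg S A] [SAlg S B]
    (ρ : Set (A × A)) (σ : Set (B × B)) (T : Set (A × A × B × B)) : Prop :=
  IsSubuniverse S T ∧
  (∀ a₁ a₂ b₁ b₂ a₁' a₂', (a₁, a₂, b₁, b₂) ∈ T → (a₁, a₁') ∈ ρ → (a₂, a₂') ∈ ρ →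
    (a₁', a₂', b₁, b₂) ∈ T) ∧
  (∀ a₁ a₂ b₁ b₂ b₁' b₂', (a₁, a₂, b₁, b₂) ∈ T → (b₁, b₁') ∈ σ → (b₂, b₂') ∈ σ →
    (a₁, a₂, b₁', b₂') ∈ T) ∧
  ρ ⊂ pr12 T ∧ σ ⊂ pr34 T ∧
  (∀ a₁ a₂ b₁ b₂, (a₁, a₂, b₁, b₂) ∈ T → ((a₁, a₂) ∈ ρ ↔ (b₁, b₂) ∈ σ))

/-- A bridge from `(A,ρ,L)` to `(B,σ,R)`: a bridge with prescribed anchors. -/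
def IsBridgeLR (S : Signature) {A B : Type} [SAlg S A] [SAlg S B]
    (ρ : Set (A × A)) (σ : Set (B × B)) (L : Set (A × A)) (R : Set (B × B))
    (T : Set (A × A × B × B)) : Prop :=
  IsBridge S ρ σ T ∧ pr12 T = L ∧ pr34 T = R

/-- A reflexive bridge (case `B = A`): `0_A ⊆ tr(T)`. -/
def ReflBridge {A : Type} (T : Set (A × A × A × A)) : Prop :=
  ∀ a : A, (a, a) ∈ btr T

/-- `Cov(ρ)`: the inclusion-minimal ρ-saturated subuniverses of `A²` properly containing ρ. -/
def Cov (S : Signature) {A : Type} [SAlg S A] (ρ : Set (A × A)) : Set (Set (A × A)) :=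
  {L | IsSubuniverse S L ∧ Saturated ρ L ∧ ρ ⊂ L ∧
    ∀ L', IsSubuniverse S L' → Saturated ρ L' → ρ ⊂ L' → L' ⊆ L → L' = L}

/-- `ref.tr(ρ,L)`: traces of reflexive bridges from `(A,ρ,L)` to itself. -/
def refTr (S : Signature) {A : Type} [SAlg S A] (ρ L : Set (A × A)) : Set (Set (A × A)) :=
  {γ | ∃ T : Set (A × A × A × A), IsBridgeLR S ρ ρ L L T ∧ ReflBridge T ∧ btr T = γ}

/-- `γ = Opt(ρ,L)`: `γ` is the (unique) inclusion-maximal member of `ref.tr(ρ,L)`. -/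
def IsOptOf (S : Signature) {A : Type} [SAlg S A] (ρ L γ : Set (A × A)) : Prop :=
  γ ∈ refTr S ρ L ∧ ∀ δ ∈ refTr S ρ L, γ ⊆ δ → δ = γ

/-- `ρ` is meet-irreducible with unique upper cover `ρplus`. -/
def MeetIrredWith (S : Signature) {A : Type} [SAlg S A] (ρ ρplus : Set (A × A)) : Prop :=
  IsCongruence S ρ ∧ ρ ≠ Set.univ ∧ IsCongruence S ρplus ∧ ρ ⊂ ρplus ∧
    ∀ θ, IsCongruence S θ → ρ ⊂ θ → ρplus ⊆ θ

/-- `Cov⁺(ρ) = {τ ∈ Cov(ρ) : τ ⊆ ρ⁺}`. -/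
def CovPlus (S : Signature) {A : Type} [SAlg S A] (ρ ρplus : Set (A × A)) :
    Set (Set (A × A)) :=
  {τ | τ ∈ Cov S ρ ∧ τ ⊆ ρplus}

/-- A good bridge between meet-irreducible congruences with upper covers `ρplus`, `σplus`. -/
def GoodBridge (S : Signature) {A B : Type} [SAlg S A] [SAlg S B]
    (ρ ρplus : Set (A × A)) (σ σplus : Set (B × B)) (T : Set (A × A × B × B)) : Prop :=
  IsBridge S ρ σ T ∧
    ∃ τ ∈ CovPlus S ρ ρplus, ∃ τ' ∈ CovPlus S σ σplus, ∃ T' ⊆ T,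
      IsBridgeLR S ρ σ τ τ' T' ∧ btr T' = btr T

/-- `t` (with Taylor-identity data `u v`) is idempotent on `A` and satisfies the
corresponding identities on `A`. -/
def TaylorOn (S : Signature) (A : Type) [SAlg S A] {n : ℕ} (t : STerm S n)
    (u v : Fin n → Fin n → Fin 2) : Prop :=
  (∀ a : A, t.eval (fun _ => a) = a) ∧
    ∀ (i : Fin n) (x y : A),
      t.eval (fun j => if u i j = 0 then x else y) =
        t.eval (fun j => if v i j = 0 then x else y)

/-- `A` is a Taylor algebra. -/
def IsTaylorAlg (S : Signature) (A : Type) [SAlg S A] : Prop :=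
  ∃ (n : ℕ) (t : STerm S n) (u v : Fin n → Fin n → Fin 2),
    1 < n ∧ (∀ i, u i i ≠ v i i) ∧ TaylorOn S A t u v

/-- `A` and `B` lie in a common (locally finite, as they are finite) Taylor variety:
they share a common Taylor term with common Taylor identities. -/
def CommonTaylor (S : Signature) (A B : Type) [SAlg S A] [SAlg S B] : Prop :=
  ∃ (n : ℕ) (t : STerm S n) (u v : Fin n → Fin n → Fin 2),
    1 < n ∧ (∀ i, u i i ≠ v i i) ∧ TaylorOn S A t u v ∧ TaylorOn S B t u v

/-- The quotient of `A` by (the equivalence relation of) `θ`. -/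
abbrev ConQuot {A : Type} (θ : Set (A × A)) : Type :=
  Quot (fun a b => (a, b) ∈ θ)

/-- The class of `a` in `A/θ`. -/
def ConQuot.mk {A : Type} (θ : Set (A × A)) (a : A) : ConQuot θ :=
  Quot.mk _ a

/-- The quotient algebra structure on `A/θ` (extensionally correct when `θ` is a
congruence). -/
noncomputable def quotAlg {S : Signature} {A : Type} (iA : SAlg S A) (θ : Set (A × A)) :
    SAlg S (ConQuot θ) :=
  ⟨fun o x => ConQuot.mk θ
    (@SAlg.interp S A iA o fun i => Classical.choose (Quot.exists_rep (x i)))⟩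

/-- `f` is a homomorphism with respect to the given algebra structures. -/
def IsHomI {S : Signature} {A B : Type} (iA : SAlg S A) (iB : SAlg S B) (f : A → B) : Prop :=
  ∀ (o : S.ops) (x : Fin (S.arity o) → A),
    f (@SAlg.interp S A iA o x) = @SAlg.interp S B iB o fun i => f (x i)

/-- The two algebras are isomorphic. -/
def IsoAlgI {S : Signature} {A B : Type} (iA : SAlg S A) (iB : SAlg S B) : Prop :=
  ∃ f : A ≃ B, IsHomI iA iB f

/-- The identity bridge `I_{(A,ρ,L)}`. -/
def idBridge {A : Type} (ρ L : Set (A × A)) : Set (A × A × A × A) :=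
  {p | (p.1, p.2.1) ∈ L ∧ (p.2.2.1, p.2.2.2) ∈ L ∧ (p.1, p.2.2.1) ∈ ρ ∧ (p.2.1, p.2.2.2) ∈ ρ}

/-- Composition of quaternary relations (bridges). -/
def bComp {A B C : Type} (T : Set (A × A × B × B)) (T' : Set (B × B × C × C)) :
    Set (A × A × C × C) :=
  {p | ∃ b₁ b₂, (p.1, p.2.1, b₁, b₂) ∈ T ∧ (b₁, b₂, p.2.2.1, p.2.2.2) ∈ T'}

/-- Converse of a quaternary relation (bridge). -/
def bConv {A B : Type} (T : Set (A × A × B × B)) : Set (B × B × A × A) :=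
  {p | (p.2.2.1, p.2.2.2, p.1, p.2.1) ∈ T}

/-- `Δ♭_{θ,α}`: the congruence `Δ_{θ,α}` of `A(θ)` viewed as a quaternary relation. -/
def deltaFlat (S : Signature) {A : Type} [SAlg S A] (θ α : Set (A × A)) :
    Set (A × A × A × A) :=
  {p | ((p.1, p.2.1), (p.2.2.1, p.2.2.2)) ∈ DeltaCon S θ α}

/-- `T^opt_{(A,ρ)} = I_{(A,ρ,ρ⁺)} ∘ Δ♭_{ρ⁺,(ρ:ρ⁺)} ∘ I_{(A,ρ,ρ⁺)}`. -/
def Topt (S : Signature) {A : Type} [SAlg S A] (ρ ρplus : Set (A × A)) :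
    Set (A × A × A × A) :=
  bComp (idBridge ρ ρplus)
    (bComp (deltaFlat S ρplus (centralizer S ρ ρplus)) (idBridge ρ ρplus))

/-- `A` is subdirectly irreducible with monolith `μ`. -/
def IsMonolith (S : Signature) {A : Type} [SAlg S A] (μ : Set (A × A)) : Prop :=
  IsCongruence S μ ∧ μ ≠ diag A ∧ ∀ θ, IsCongruence S θ → θ ≠ diag A → μ ⊆ θ

/-- The carrier of `D(A,θ)`-style quotients: `A(μ)/Δ_{μ,α}`. -/
abbrev DCar (S : Signature) (A : Type) [SAlg S A] (μ α : Set (A × A)) : Type :=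
  Quot (fun p q : ↥μ => ((p : A × A), (q : A × A)) ∈ DeltaCon S μ α)

/-- The class of a pair `p ∈ μ` in `A(μ)/Δ_{μ,α}`. -/
def DCar.mk (S : Signature) (A : Type) [SAlg S A] (μ α : Set (A × A)) (p : ↥μ) :
    DCar S A μ α :=
  Quot.mk _ p

/-- The algebra structure on `A(μ)/Δ_{μ,α}` (extensionally correct when `μ` is a
congruence and `Δ_{μ,α}` is a congruence of `A(μ)`). -/
noncomputable def DAlg (S : Signature) (A : Type) [SAlg S A] (μ α : Set (A × A))
    (h : IsSubuniverse S μ) : SAlg S (DCar S A μ α) :=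
  letI := subAlg μ h
  ⟨fun o x => DCar.mk S A μ α
    (SAlg.interp o fun i => Classical.choose (Quot.exists_rep (x i)))⟩

/-- The canonical similarity bridge `T_{D(A)}` from `A` to `D(A)`. -/
def TDBridge (S : Signature) (A : Type) [SAlg S A] (μ α : Set (A × A)) :
    Set (A × A × DCar S A μ α × DCar S A μ α) :=
  {x | ∃ (a b e : A) (_ : (a, b) ∈ μ) (h1 : (a, e) ∈ μ) (h2 : (b, e) ∈ μ),
    x = (a, b, DCar.mk S A μ α ⟨(a, e), h1⟩, DCar.mk S A μ α ⟨(b, e), h2⟩)}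

/-- Similarity of (subdirectly irreducible) algebras: `D(A) ≅ D(B)`, where `D(X)` is
`X(μ)/Δ_{μ,(0:μ)}` if the monolith `μ` is abelian, and `X` itself otherwise. -/
def SimilarI (S : Signature) {A B : Type} (iA : SAlg S A) (iB : SAlg S B) : Prop :=
  letI := iA
  letI := iB
  ∃ (μA : Set (A × A)) (μB : Set (B × B)) (hA : IsMonolith S μA) (hB : IsMonolith S μB),
    ((Centralizes S μA μA (diag A) ∧ Centralizes S μB μB (diag B)) →
      IsoAlgI (DAlg S A μA (centralizer S (diag A) μA) hA.1.1)
        (DAlg S B μB (centralizer S (diag B) μB) hB.1.1)) ∧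
    ((Centralizes S μA μA (diag A) ∧ ¬ Centralizes S μB μB (diag B)) →
      IsoAlgI (DAlg S A μA (centralizer S (diag A) μA) hA.1.1) iB) ∧
    ((¬ Centralizes S μA μA (diag A) ∧ Centralizes S μB μB (diag B)) →
      IsoAlgI iA (DAlg S B μB (centralizer S (diag B) μB) hB.1.1)) ∧
    ((¬ Centralizes S μA μA (diag A) ∧ ¬ Centralizes S μB μB (diag B)) →
      IsoAlgI iA iB)

end Zhuk

namespace Zhuk

/-- Simultaneous substitution of terms for the variables of a term. -/
def STerm.subst {S : Signature} {n m : ℕ} (σ : Fin n → STerm S m) : STerm S n → STerm S m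
  | .var i => σ i
  | .app o ts => .app o fun i => (ts i).subst σ

theorem STerm.eval_subst {S : Signature} {A : Type} [SAlg S A] {n m : ℕ}
    (σ : Fin n → STerm S m) (t : STerm S n) (v : Fin m → A) :
    (t.subst σ).eval v = t.eval fun i => (σ i).eval v := by
  induction t with
  | var i => rfl
  | app o ts ih => simp only [STerm.subst, STerm.eval, ih]

/-- Pairs of elements of `A(θ)` that no unary polynomial of `A(θ)` separates
with respect to membership in `δ`. -/
def polyIndist (S : Signature) {A : Type} [SAlg S A] (θ δ : Set (A × A)) :
    Set ((A × A) × (A × A)) :=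
  {x | x.1 ∈ θ ∧ x.2 ∈ θ ∧ ∀ (n : ℕ) (t : STerm S (n + 1)) (c d : Fin n → A),
    (∀ i, (c i, d i) ∈ θ) →
    ((t.eval (Fin.cons x.1.1 c), t.eval (Fin.cons x.1.2 d)) ∈ δ ↔
      (t.eval (Fin.cons x.2.1 c), t.eval (Fin.cons x.2.2 d)) ∈ δ)}

theorem polyIndist.eval_update_iff {S : Signature} {A : Type} [SAlg S A] {θ δ : Set (A × A)}
    {p q : A × A} (h : (p, q) ∈ polyIndist S θ δ) {n : ℕ} (t : STerm S n) (i : Fin n)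
    (c d : Fin n → A) (hcd : ∀ i, (c i, d i) ∈ θ) :
    (t.eval (Function.update c i p.1), t.eval (Function.update d i p.2)) ∈ δ ↔
      (t.eval (Function.update c i q.1), t.eval (Function.update d i q.2)) ∈ δ := by
  have key (a : A) (v : Fin n → A) :
      (t.subst fun j => .var (if j = i then 0 else j.succ)).eval (Fin.cons a v) =
        t.eval (Function.update v i a) := by
    rw [STerm.eval_subst]
    congr 1
    funext j
    by_cases hj : j = i <;> simp [STerm.eval, hj]
  simpa only [key] using h.2.2 n (t.subst fun j => .var (if j = i then 0 else j.succ)) c d hcd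

theorem polyIndist.eval_iff {S : Signature} {A : Type} [SAlg S A] {θ δ : Set (A × A)}
    {n : ℕ} (t : STerm S n) (p q : Fin n → A × A)
    (h : ∀ i, (p i, q i) ∈ polyIndist S θ δ) :
    (t.eval fun i => (p i).1, t.eval fun i => (p i).2) ∈ δ ↔
      (t.eval fun i => (q i).1, t.eval fun i => (q i).2) ∈ δ := by
  have key (s : Finset (Fin n)) :
      (t.eval fun i => (p i).1, t.eval fun i => (p i).2) ∈ δ ↔
        (t.eval fun i => (s.piecewise q p i).1, t.eval fun i => (s.piecewise q p i).2) ∈ δ := by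
    induction s using Finset.induction_on with
    | empty => simp
    | insert i s hi ih =>
      have hmem (j : Fin n) : s.piecewise q p j ∈ θ := by
        by_cases hj : j ∈ s
        · simpa [hj] using (h j).2.1
        · simpa [hj] using (h j).1
      have hstep := polyIndist.eval_update_iff (h i) t i
        (fun j => (s.piecewise q p j).1) (fun j => (s.piecewise q p j).2) hmem
      have hupd (f : A × A → A) (r : A × A) :
          Function.update (fun j => f (s.piecewise q p j)) i (f r) =
            fun j => f (Function.update (s.piecewise q p) i r j) := by
        funext j
        by_cases hj : j = i
        · subst hj; simp
        · simp [hj]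
      rw [hupd Prod.fst, hupd Prod.snd, hupd Prod.fst, hupd Prod.snd] at hstep
      have hself : Function.update (s.piecewise q p) i (p i) = s.piecewise q p := by
        rw [← Finset.piecewise_eq_of_notMem s q p hi, Function.update_eq_self]
      rw [hself] at hstep
      rw [ih, hstep, Finset.piecewise_insert]
  simpa using key Finset.univ

theorem polyIndist_self {S : Signature} {A : Type} [SAlg S A] {θ δ : Set (A × A)}
    {p : A × A} (hp : p ∈ θ) : (p, p) ∈ polyIndist S θ δ :=
  ⟨hp, hp, fun _ _ _ _ _ => Iff.rfl⟩

theorem isSubuniverse_polyIndist {S : Signature} {A : Type} [SAlg S A] {θ : Set (A × A)}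
    (δ : Set (A × A)) (hθ : IsSubuniverse S θ) : IsSubuniverse S (polyIndist S θ δ) := by
  intro o x hx
  refine ⟨hθ o _ fun i => (hx i).1, hθ o _ fun i => (hx i).2.1, fun n t c d hcd => ?_⟩
  let σ : Fin (n + 1) → STerm S (S.arity o + n) :=
    Fin.cons (.app o fun i => .var (Fin.castAdd n i)) fun k => .var (Fin.natAdd _ k)
  have key (y : Fin (S.arity o) → A × A) (f : A × A → A) :
      (t.subst σ).eval (fun i => f (Fin.append y (fun k => (c k, d k)) i)) =
        t.eval (Fin.cons (SAlg.interp o fun i => f (y i)) fun k => f (c k, d k)) := by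
    rw [STerm.eval_subst]
    congr 1
    funext j
    refine Fin.cases ?_ (fun k => ?_) j <;> simp [σ, STerm.eval]
  have h := polyIndist.eval_iff (θ := θ) (δ := δ) (t.subst σ)
    (Fin.append (fun i => (x i).1) fun k => (c k, d k))
    (Fin.append (fun i => (x i).2) fun k => (c k, d k)) (by
      intro i
      refine Fin.addCases (fun j => ?_) (fun k => ?_) i
      · simpa using hx j
      · simpa using polyIndist_self (hcd k))
  rwa [key _ Prod.fst, key _ Prod.snd, key _ Prod.fst, key _ Prod.snd] at h

theorem isConOn_polyIndist {S : Signature} {A : Type} [SAlg S A] {θ : Set (A × A)}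
    (δ : Set (A × A)) (hθ : IsSubuniverse S θ) : IsConOn S θ (polyIndist S θ δ) :=
  ⟨fun _ hx => ⟨hx.1, hx.2.1⟩, isSubuniverse_polyIndist δ hθ, fun _ => polyIndist_self,
    fun _ _ h => ⟨h.2.1, h.1, fun n t c d hcd => (h.2.2 n t c d hcd).symm⟩,
    fun _ _ _ h h' => ⟨h.1, h'.2.1, fun n t c d hcd =>
      (h.2.2 n t c d hcd).trans (h'.2.2 n t c d hcd)⟩⟩

theorem Centralizes.deltaCon_subset_polyIndist {S : Signature} {A : Type} [SAlg S A]
    {α θ δ : Set (A × A)} (hC : Centralizes S α θ δ) (hθ : IsCongruence S θ)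
    (hα : IsCongruence S α) : DeltaCon S θ α ⊆ polyIndist S θ δ :=
  Set.sInter_subset_of_mem ⟨isConOn_polyIndist δ hθ.1, fun a b hab =>
    ⟨hθ.2.refl a, hθ.2.refl b, fun n t c d hcd =>
      ⟨hC n t a b c d hab hcd, hC n t b a c d (hα.2.symm hab) hcd⟩⟩⟩

end Zhuk

/-- If `θ ≤ α` are congruences and `C(α, θ; δ)` holds, then every pair
`((a,a'),(b,b')) ∈ Δ_{θ,α}` satisfies `(a,a') ∈ δ ↔ (b,b') ∈ δ`. -/
theorem stmt_0 {S : Zhuk.Signature} {A : Type} [Zhuk.SAlg S A]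
    (δ θ α : Set (A × A))
    (hδ : Zhuk.IsCongruence S δ) (hθ : Zhuk.IsCongruence S θ) (hα : Zhuk.IsCongruence S α)
    (hθα : θ ⊆ α) (hC : Zhuk.Centralizes S α θ δ) :
    ∀ a a' b b' : A, ((a, a'), (b, b')) ∈ Zhuk.DeltaCon S θ α →
      ((a, a') ∈ δ ↔ (b, b') ∈ δ) := by
  intro a a' b b' h
  exact (hC.deltaCon_subset_polyIndist hθ hα h).2.2 0 (.var 0) Fin.elim0 Fin.elim0
    fun i => i.elim0
end

section
/- Let A and B be finite algebras in a common signature, ρ ∈ Con*(A), σ ∈ Con*(B), and let T be a bridge from (A,ρ) to (B,σ). Then for every L' ∈ Cov(ρ) with L' ⊆ pr_{1,2}(T) there exists a compact bridge T' from (A,ρ) to (B,σ) with T' ⊆ T, pr_{1,2}(T') = L', and tr(T') = tr(T). -/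
namespace Zhuk

variable {S : Signature} {A B : Type}

lemma saturated_iff {ρ R : Set (A × A)} (hρ : Equivalence fun a b => (a, b) ∈ ρ) :
    Saturated ρ R ↔ ∀ a b a' b', (a, b) ∈ R → (a, a') ∈ ρ → (b, b') ∈ ρ → (a', b') ∈ R := by
  constructor
  · intro h a b a' b' hR ha hb
    rw [← h]
    exact ⟨a, hρ.symm ha, b, hR, hb⟩
  · intro h
    ext ⟨a, b⟩
    constructor
    · rintro ⟨c, hc, d, hR, hd⟩
      exact h c d a b hR (hρ.symm hc) hd
    · intro hR
      exact ⟨a, hρ.refl a, b, hR, hρ.refl b⟩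

/-- The restriction of a quaternary relation to pairs of first coordinates in `L`. -/
def restrictLeft (T : Set (A × A × B × B)) (L : Set (A × A)) : Set (A × A × B × B) :=
  {p | p ∈ T ∧ (p.1, p.2.1) ∈ L}

lemma restrictLeft_subset (T : Set (A × A × B × B)) (L : Set (A × A)) :
    restrictLeft T L ⊆ T := fun _ h => h.1

lemma pr12_restrictLeft {T : Set (A × A × B × B)} {L : Set (A × A)} (h : L ⊆ pr12 T) :
    pr12 (restrictLeft T L) = L := by
  ext p
  constructor
  · rintro ⟨b₁, b₂, -, hL⟩
    exact hL
  · intro hL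
    obtain ⟨b₁, b₂, hT⟩ := h hL
    exact ⟨b₁, b₂, hT, hL⟩

section Algebra

variable [SAlg S A] [SAlg S B]

lemma isSubuniverse_pr12 {T : Set (A × A × B × B)} (hT : IsSubuniverse S T) :
    IsSubuniverse S (pr12 T) := by
  intro o x hx
  choose b₁ b₂ hb using hx
  exact ⟨_, _, hT o (fun i => ((x i).1, (x i).2, b₁ i, b₂ i)) hb⟩

lemma isSubuniverse_bConv {T : Set (A × A × B × B)} (hT : IsSubuniverse S T) :
    IsSubuniverse S (bConv T) := by
  intro o x hx
  exact hT o (fun i => ((x i).2.2.1, (x i).2.2.2, (x i).1, (x i).2.1)) hx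

lemma isSubuniverse_restrictLeft {T : Set (A × A × B × B)} {L : Set (A × A)}
    (hT : IsSubuniverse S T) (hL : IsSubuniverse S L) :
    IsSubuniverse S (restrictLeft T L) := fun o x hx =>
  ⟨hT o x fun i => (hx i).1, hL o (fun i => ((x i).1, (x i).2.1)) fun i => (hx i).2⟩

lemma exists_mem_cov_subset [Finite A] {ρ R : Set (A × A)} (hR : IsSubuniverse S R)
    (hs : Saturated ρ R) (hρR : ρ ⊂ R) : ∃ L ∈ Cov S ρ, L ⊆ R := by
  obtain ⟨L, hLR, hL⟩ := exists_minimal_le_of_wellFoundedLT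
    (fun L : Set (A × A) => IsSubuniverse S L ∧ Saturated ρ L ∧ ρ ⊂ L) R ⟨hR, hs, hρR⟩
  exact ⟨L, ⟨hL.prop.1, hL.prop.2.1, hL.prop.2.2, fun L' h₁ h₂ h₃ h₄ =>
    h₄.antisymm (hL.le_of_le ⟨h₁, h₂, h₃⟩ h₄)⟩, hLR⟩

namespace IsBridge

variable {ρ : Set (A × A)} {σ : Set (B × B)} {T : Set (A × A × B × B)}

lemma conv (hT : IsBridge S ρ σ T) : IsBridge S σ ρ (bConv T) := by
  obtain ⟨hs, hl, hr, hL, hR, hb⟩ := hT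
  exact ⟨isSubuniverse_bConv hs, fun _ _ _ _ _ _ h h₁ h₂ => hr _ _ _ _ _ _ h h₁ h₂,
    fun _ _ _ _ _ _ h h₁ h₂ => hl _ _ _ _ _ _ h h₁ h₂, hR, hL,
    fun _ _ _ _ h => (hb _ _ _ _ h).symm⟩

lemma saturated_pr12 (hT : IsBridge S ρ σ T) (hρ : IsCongruence S ρ) :
    Saturated ρ (pr12 T) := by
  rw [saturated_iff hρ.2]
  rintro a b a' b' ⟨b₁, b₂, h⟩ ha hb
  exact ⟨b₁, b₂, hT.2.1 _ _ _ _ _ _ h ha hb⟩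

/-- Restricting a bridge to a saturated subuniverse of its left anchor properly containing `ρ`
gives a bridge. -/
lemma restrictLeft (hT : IsBridge S ρ σ T) (hρ : IsCongruence S ρ) {L : Set (A × A)}
    (hL : IsSubuniverse S L) (hs : Saturated ρ L) (hρL : ρ ⊂ L) (hLT : L ⊆ pr12 T) :
    IsBridge S ρ σ (restrictLeft T L) := by
  obtain ⟨hsub, hl, hr, -, hR, hb⟩ := hT
  rw [saturated_iff hρ.2] at hs
  refine ⟨isSubuniverse_restrictLeft hsub hL,
    fun _ _ _ _ _ _ h h₁ h₂ => ⟨hl _ _ _ _ _ _ h.1 h₁ h₂, hs _ _ _ _ h.2 h₁ h₂⟩,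
    fun _ _ _ _ _ _ h h₁ h₂ => ⟨hr _ _ _ _ _ _ h.1 h₁ h₂, h.2⟩,
    (pr12_restrictLeft hLT).symm ▸ hρL, ?_, fun _ _ _ _ h => hb _ _ _ _ h.1⟩
  rw [Set.ssubset_iff_exists]
  constructor
  · intro q hq
    obtain ⟨a₁, a₂, h⟩ := hR.1 hq
    exact ⟨a₁, a₂, h, hρL.1 ((hb _ _ _ _ h).2 hq)⟩
  · obtain ⟨p, hpL, hpρ⟩ := Set.exists_of_ssubset hρL
    obtain ⟨b₁, b₂, h⟩ := hLT hpL
    exact ⟨(b₁, b₂), ⟨p.1, p.2, h, hpL⟩, fun hσ => hpρ ((hb _ _ _ _ h).2 hσ)⟩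

end IsBridge

end Algebra

lemma btr_restrictLeft {ρ L : Set (A × A)} (T : Set (A × A × B × B))
    (hρ : Equivalence fun a b => (a, b) ∈ ρ) (hρL : ρ ⊆ L) :
    btr (restrictLeft T L) = btr T := by
  ext p
  exact ⟨fun h => h.1, fun h => ⟨h, hρL (hρ.refl p.1)⟩⟩

end Zhuk

/-- every bridge can be restricted to a compact bridge with prescribed
left anchor `L' ∈ Cov(ρ)` contained in `pr₁₂(T)`, without changing the trace. -/
theorem stmt_1 {S : Zhuk.Signature} {A B : Type} [Zhuk.SAlg S A] [Zhuk.SAlg S B]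
    [Finite A] [Finite B]
    (ρ : Set (A × A)) (σ : Set (B × B))
    (hρ : Zhuk.ConStar S ρ) (hσ : Zhuk.ConStar S σ)
    (T : Set (A × A × B × B)) (hT : Zhuk.IsBridge S ρ σ T) :
    ∀ L' ∈ Zhuk.Cov S ρ, L' ⊆ Zhuk.pr12 T →
      ∃ T' : Set (A × A × B × B), T' ⊆ T ∧ Zhuk.IsBridge S ρ σ T' ∧
        Zhuk.pr12 T' ∈ Zhuk.Cov S ρ ∧ Zhuk.pr34 T' ∈ Zhuk.Cov S σ ∧
        Zhuk.pr12 T' = L' ∧ Zhuk.btr T' = Zhuk.btr T := by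
  intro L' hL' hL'T
  have hT₁ := hT.restrictLeft hρ.1 hL'.1 hL'.2.1 hL'.2.2.1 hL'T
  have hl₁ : Zhuk.pr12 (Zhuk.restrictLeft T L') = L' := Zhuk.pr12_restrictLeft hL'T
  obtain ⟨R, hR, hRT⟩ := Zhuk.exists_mem_cov_subset (Zhuk.isSubuniverse_pr12 hT₁.conv.1)
    (hT₁.conv.saturated_pr12 hσ.1) hT₁.conv.2.2.2.1
  set T₂ := Zhuk.bConv (Zhuk.restrictLeft (Zhuk.bConv (Zhuk.restrictLeft T L')) R)
  have hT₂ : Zhuk.IsBridge S ρ σ T₂ :=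
    (hT₁.conv.restrictLeft hσ.1 hR.1 hR.2.1 hR.2.2.1 hRT).conv
  have hsub : T₂ ⊆ Zhuk.restrictLeft T L' := fun _ h => h.1
  have hl₂ : Zhuk.pr12 T₂ = L' := by
    refine hL'.2.2.2 _ (Zhuk.isSubuniverse_pr12 hT₂.1) (hT₂.saturated_pr12 hρ.1) hT₂.2.2.2.1 ?_
    rintro p ⟨b₁, b₂, h⟩
    exact (hsub h).2
  have hr₂ : Zhuk.pr34 T₂ = R := Zhuk.pr12_restrictLeft hRT
  refine ⟨T₂, hsub.trans (Zhuk.restrictLeft_subset T L'), hT₂, hl₂ ▸ hL', hr₂ ▸ hR, hl₂, ?_⟩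
  ext p
  rw [← Zhuk.btr_restrictLeft T hρ.1.2 hL'.2.2.1.1]
  exact ⟨fun h => hsub h, fun h => ⟨h, hR.2.2.1.1 (hσ.1.2.refl p.2)⟩⟩
end

section
/- Let A be a finite algebra, ρ ∈ Con*(A), and L ∈ Cov(ρ). Then ref.tr(ρ,L) is nonempty, closed under relational inverse and composition, and has a unique inclusion-maximal member Opt(ρ,L); moreover Opt(ρ,L) is a congruence of A containing ρ. -/
namespace Zhuk

/-- A saturated relation absorbs `ρ` on both sides. -/
theorem Saturated.mem_of_mem {A : Type} {ρ L : Set (A × A)} (h : Saturated ρ L) {a b a' b' : A}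
    (ha : (a', a) ∈ ρ) (hab : (a, b) ∈ L) (hb : (b, b') ∈ ρ) : (a', b') ∈ L :=
  h ▸ ⟨a, ha, b, hab, hb⟩

theorem isBridgeLR_idBridge {S : Signature} {A : Type} [SAlg S A] {ρ L : Set (A × A)}
    (hρ : IsCongruence S ρ) (hL : IsSubuniverse S L) (hs : Saturated ρ L) (hlt : ρ ⊂ L) :
    IsBridgeLR S ρ ρ L L (idBridge ρ L) := by
  obtain ⟨hsub, hrefl, hsymm, htrans⟩ := hρ
  have h12 : pr12 (idBridge ρ L) = L := by
    ext ⟨a, b⟩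
    exact ⟨fun ⟨_, _, h, _⟩ => h, fun h => ⟨a, b, h, h, hrefl a, hrefl b⟩⟩
  have h34 : pr34 (idBridge ρ L) = L := by
    ext ⟨a, b⟩
    exact ⟨fun ⟨_, _, _, h, _⟩ => h, fun h => ⟨a, b, h, h, hrefl a, hrefl b⟩⟩
  refine ⟨⟨?_, ?_, ?_, by rwa [h12], by rwa [h34], ?_⟩, h12, h34⟩
  · intro o x hx
    exact ⟨hL o _ fun i => (hx i).1, hL o _ fun i => (hx i).2.1,
      hsub o _ fun i => (hx i).2.2.1, hsub o _ fun i => (hx i).2.2.2⟩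
  · rintro a₁ a₂ b₁ b₂ a₁' a₂' ⟨h, h', h₁, h₂⟩ h₁' h₂'
    exact ⟨hs.mem_of_mem (hsymm h₁') h h₂', h', htrans (hsymm h₁') h₁, htrans (hsymm h₂') h₂⟩
  · rintro a₁ a₂ b₁ b₂ b₁' b₂' ⟨h, h', h₁, h₂⟩ h₁' h₂'
    exact ⟨h, hs.mem_of_mem (hsymm h₁') h' h₂', htrans h₁ h₁', htrans h₂ h₂'⟩
  · rintro a₁ a₂ b₁ b₂ ⟨-, -, h₁, h₂⟩
    exact ⟨fun h => htrans (hsymm h₁) (htrans h h₂), fun h => htrans h₁ (htrans h (hsymm h₂))⟩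

theorem btr_idBridge {A : Type} {ρ L : Set (A × A)} (hL : ∀ a, (a, a) ∈ L) :
    btr (idBridge ρ L) = ρ := by
  ext ⟨a, b⟩
  exact ⟨fun h => h.2.2.1, fun h => ⟨hL a, hL b, h, h⟩⟩

theorem IsBridgeLR.bConv {S : Signature} {A B : Type} [SAlg S A] [SAlg S B]
    {ρ L : Set (A × A)} {σ R : Set (B × B)} {T : Set (A × A × B × B)}
    (h : IsBridgeLR S ρ σ L R T) : IsBridgeLR S σ ρ R L (bConv T) := by
  obtain ⟨⟨hT, hA, hB, h12, h34, hiff⟩, hL, hR⟩ := h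
  have h12' : pr12 (Zhuk.bConv T) = pr34 T := rfl
  have h34' : pr34 (Zhuk.bConv T) = pr12 T := rfl
  exact ⟨⟨fun o x hx => hT o (fun i => ((x i).2.2.1, (x i).2.2.2, (x i).1, (x i).2.1)) hx,
    fun _ _ _ _ _ _ h => hB _ _ _ _ _ _ h, fun _ _ _ _ _ _ h => hA _ _ _ _ _ _ h,
    h12' ▸ h34, h34' ▸ h12, fun _ _ _ _ h => (hiff _ _ _ _ h).symm⟩, hR, hL⟩

theorem IsBridgeLR.bComp {S : Signature} {A B C : Type} [SAlg S A] [SAlg S B] [SAlg S C]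
    {ρ L : Set (A × A)} {σ R : Set (B × B)} {τ M : Set (C × C)}
    {T : Set (A × A × B × B)} {T' : Set (B × B × C × C)}
    (h : IsBridgeLR S ρ σ L R T) (h' : IsBridgeLR S σ τ R M T') :
    IsBridgeLR S ρ τ L M (bComp T T') := by
  obtain ⟨⟨hT, hA, -, hρL, -, hiff⟩, rfl, hR⟩ := h
  obtain ⟨⟨hT', -, hC, -, hτM, hiff'⟩, hR', rfl⟩ := h'
  have h12 : pr12 (Zhuk.bComp T T') = pr12 T := by
    ext ⟨a₁, a₂⟩
    constructor
    · rintro ⟨_, _, b₁, b₂, h, -⟩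
      exact ⟨b₁, b₂, h⟩
    · rintro ⟨b₁, b₂, h⟩
      have hb : (b₁, b₂) ∈ pr12 T' := by
        rw [hR', ← hR]
        exact ⟨a₁, a₂, h⟩
      obtain ⟨c₁, c₂, h'⟩ := hb
      exact ⟨c₁, c₂, b₁, b₂, h, h'⟩
  have h34 : pr34 (Zhuk.bComp T T') = pr34 T' := by
    ext ⟨c₁, c₂⟩
    constructor
    · rintro ⟨_, _, b₁, b₂, -, h'⟩
      exact ⟨b₁, b₂, h'⟩
    · rintro ⟨b₁, b₂, h'⟩
      have hb : (b₁, b₂) ∈ pr34 T := by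
        rw [hR, ← hR']
        exact ⟨c₁, c₂, h'⟩
      obtain ⟨a₁, a₂, h⟩ := hb
      exact ⟨a₁, a₂, b₁, b₂, h, h'⟩
  refine ⟨⟨?_, ?_, ?_, by rwa [h12], by rwa [h34], ?_⟩, h12, h34⟩
  · intro o x hx
    choose b₁ b₂ h h' using hx
    exact ⟨SAlg.interp o b₁, SAlg.interp o b₂, hT o _ h, hT' o _ h'⟩
  · rintro a₁ a₂ c₁ c₂ a₁' a₂' ⟨b₁, b₂, h, h'⟩ h₁ h₂
    exact ⟨b₁, b₂, hA _ _ _ _ _ _ h h₁ h₂, h'⟩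
  · rintro a₁ a₂ c₁ c₂ c₁' c₂' ⟨b₁, b₂, h, h'⟩ h₁ h₂
    exact ⟨b₁, b₂, h, hC _ _ _ _ _ _ h' h₁ h₂⟩
  · rintro a₁ a₂ c₁ c₂ ⟨b₁, b₂, h, h'⟩
    exact (hiff _ _ _ _ h).trans (hiff' _ _ _ _ h')

theorem btr_bComp {S : Signature} {A B C : Type} [SAlg S A] [SAlg S B] [SAlg S C]
    {ρ : Set (A × A)} {σ : Set (B × B)} {τ : Set (C × C)}
    {T : Set (A × A × B × B)} {T' : Set (B × B × C × C)}
    (hρ : ∀ a, (a, a) ∈ ρ) (hσ : Equivalence fun a b => (a, b) ∈ σ)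
    (h : IsBridge S ρ σ T) (h' : IsBridge S σ τ T') :
    btr (bComp T T') = rcomp (btr T) (btr T') := by
  obtain ⟨-, -, hB, -, -, hiff⟩ := h
  obtain ⟨-, hB', -⟩ := h'
  ext ⟨a, c⟩
  constructor
  · rintro ⟨b₁, b₂, h, h'⟩
    have hb : (b₂, b₁) ∈ σ := hσ.symm ((hiff _ _ _ _ h).1 (hρ a))
    exact ⟨b₁, hB _ _ _ _ _ _ h (hσ.refl b₁) hb, hB' _ _ _ _ _ _ h' (hσ.refl b₁) hb⟩
  · rintro ⟨b, h, h'⟩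
    exact ⟨b, b, h, h'⟩

theorem isSubuniverse_btr {S : Signature} {A B : Type} [SAlg S A] [SAlg S B]
    {T : Set (A × A × B × B)} (hT : IsSubuniverse S T) : IsSubuniverse S (btr T) :=
  fun o x hx => hT o (fun i => ((x i).1, (x i).1, (x i).2, (x i).2)) hx

section RefTr

variable {S : Signature} {A : Type} [SAlg S A] {ρ L γ δ : Set (A × A)}

theorem isSubuniverse_of_mem_refTr (h : γ ∈ refTr S ρ L) : IsSubuniverse S γ := by
  obtain ⟨T, hT, -, rfl⟩ := h
  exact isSubuniverse_btr hT.1.1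

theorem refl_of_mem_refTr (h : γ ∈ refTr S ρ L) (a : A) : (a, a) ∈ γ := by
  obtain ⟨T, -, hT, rfl⟩ := h
  exact hT a

theorem self_mem_refTr (hρ : IsCongruence S ρ) (hL : L ∈ Cov S ρ) : ρ ∈ refTr S ρ L := by
  have htr : btr (idBridge ρ L) = ρ := btr_idBridge fun a => hL.2.2.1.1 (hρ.2.refl a)
  exact ⟨idBridge ρ L, isBridgeLR_idBridge hρ hL.1 hL.2.1 hL.2.2.1,
    fun a => htr.ge (hρ.2.refl a), htr⟩

theorem rinv_mem_refTr (h : γ ∈ refTr S ρ L) : rinv γ ∈ refTr S ρ L := by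
  obtain ⟨T, hT, hr, rfl⟩ := h
  exact ⟨bConv T, hT.bConv, hr, rfl⟩

theorem rcomp_mem_refTr (hρ : IsCongruence S ρ) (hγ : γ ∈ refTr S ρ L) (hδ : δ ∈ refTr S ρ L) :
    rcomp γ δ ∈ refTr S ρ L := by
  obtain ⟨T, hT, hr, rfl⟩ := hγ
  obtain ⟨T', hT', hr', rfl⟩ := hδ
  exact ⟨bComp T T', hT.bComp hT', fun a => ⟨a, a, hr a, hr' a⟩,
    btr_bComp hρ.2.refl hρ.2 hT.1 hT'.1⟩

/-- An inclusion-maximal member of `refTr S ρ L` is its greatest member. -/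
theorem IsOptOf.subset_of_mem (hρ : IsCongruence S ρ) (hγ : IsOptOf S ρ L γ)
    (hδ : δ ∈ refTr S ρ L) : δ ⊆ γ := by
  have h := hγ.2 _ (rcomp_mem_refTr hρ hγ.1 hδ)
    fun p hp => ⟨p.2, hp, refl_of_mem_refTr hδ p.2⟩
  intro p hp
  rw [← h]
  exact ⟨p.1, refl_of_mem_refTr hγ.1 p.1, hp⟩

theorem IsOptOf.isCongruence (hρ : IsCongruence S ρ) (hγ : IsOptOf S ρ L γ) :
    IsCongruence S γ :=
  ⟨isSubuniverse_of_mem_refTr hγ.1, refl_of_mem_refTr hγ.1,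
    fun h => hγ.subset_of_mem hρ (rinv_mem_refTr hγ.1) h,
    fun h h' => hγ.subset_of_mem hρ (rcomp_mem_refTr hρ hγ.1 hγ.1) ⟨_, h, h'⟩⟩

theorem exists_isOptOf [Finite A] (h : (refTr S ρ L).Nonempty) : ∃ γ, IsOptOf S ρ L γ := by
  obtain ⟨γ, hγ⟩ := (Set.toFinite (refTr S ρ L)).exists_maximal h
  exact ⟨γ, hγ.prop, fun δ hδ hle => (hγ.eq_of_le hδ hle).symm⟩

end RefTr

end Zhuk

/-- `ref.tr(ρ,L)` is nonempty, closed under relational inverse and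
composition, has a unique inclusion-maximal member `Opt(ρ,L)`, which is a congruence
containing `ρ`. -/
theorem stmt_2 {S : Zhuk.Signature} {A : Type} [Zhuk.SAlg S A] [Finite A]
    (ρ : Set (A × A)) (hρ : Zhuk.ConStar S ρ)
    (L : Set (A × A)) (hL : L ∈ Zhuk.Cov S ρ) :
    (Zhuk.refTr S ρ L).Nonempty ∧
    (∀ γ ∈ Zhuk.refTr S ρ L, Zhuk.rinv γ ∈ Zhuk.refTr S ρ L) ∧
    (∀ γ ∈ Zhuk.refTr S ρ L, ∀ δ ∈ Zhuk.refTr S ρ L, Zhuk.rcomp γ δ ∈ Zhuk.refTr S ρ L) ∧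
    (∃! γ, Zhuk.IsOptOf S ρ L γ) ∧
    (∀ γ, Zhuk.IsOptOf S ρ L γ → Zhuk.IsCongruence S γ ∧ ρ ⊆ γ) := by
  have hmem := Zhuk.self_mem_refTr hρ.1 hL
  refine ⟨⟨ρ, hmem⟩, fun _ => Zhuk.rinv_mem_refTr, fun _ hγ _ => Zhuk.rcomp_mem_refTr hρ.1 hγ, ?_,
    fun γ hγ => ⟨hγ.isCongruence hρ.1, hγ.subset_of_mem hρ.1 hmem⟩⟩
  obtain ⟨γ, hγ⟩ := Zhuk.exists_isOptOf ⟨ρ, hmem⟩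
  exact ⟨γ, hγ, fun δ hδ => (hγ.subset_of_mem hρ.1 hδ.1).antisymm (hδ.subset_of_mem hρ.1 hγ.1)⟩
end
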